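/- Let σ : F → F be a field automorphism of finite order m and let θ : L → L be an extension of σ of degree ℓ, i.e., L/F is a field extension of degree ℓ, the restriction of θ to F equals σ, and L^θ = F^σ (so the order of θ is ℓm). Let n = ℓm, let h ∈ L^n have entries linearly independent over L^θ (hence an L^θ-basis of L), and let T ⊆ ℤ. Then the dimension over F of the subfield subcode C_(θ,h,T) ∩ F^n equals ℓ·(m − κ), where κ is the number of distinct residues modulo m of the elements of T. -/

import Mathlib

/-- The fixed subfield of a field automorphism `σ : F ≃+* F`. -/
def fixedField {F : Type*} [Field F] (σ : F ≃+* F) : Subfield F where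
  carrier := {x | σ x = x}
  mul_mem' := by
    intro a b ha hb
    simp only [Set.mem_setOf_eq] at *
    rw [map_mul, ha, hb]
  one_mem' := by simp only [Set.mem_setOf_eq, map_one]
  add_mem' := by
    intro a b ha hb
    simp only [Set.mem_setOf_eq] at *
    rw [map_add, ha, hb]
  zero_mem' := by simp only [Set.mem_setOf_eq, map_zero]
  neg_mem' := by
    intro a ha
    simp only [Set.mem_setOf_eq] at *
    rw [map_neg, ha]
  inv_mem' := by
    intro a ha
    simp only [Set.mem_setOf_eq] at *
    rw [map_inv₀, ha]

/-- The subfield subcode `C_(θ,h,T) ∩ F^ι` as an `F`-submodule of `ι → F`. -/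
def subfieldSubcode {F L : Type*} [Field F] [Field L] [Algebra F L] {ι : Type*} [Fintype ι]
    (θ : L ≃+* L) (h : ι → L) (T : Set ℤ) : Submodule F (ι → F) where
  carrier := {c : ι → F | ∀ i ∈ T, ∑ j, algebraMap F L (c j) * (θ ^ i) (h j) = 0}
  add_mem' := by
    intro a b ha hb i hi
    simp only [Pi.add_apply, map_add, add_mul, Finset.sum_add_distrib]
    rw [ha i hi, hb i hi, add_zero]
  zero_mem' := by
    intro i hi
    simp
  smul_mem' := by
    intro t x hx i hi
    simp only [Pi.smul_apply, smul_eq_mul, map_mul, mul_assoc, ← Finset.mul_sum]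
    rw [hx i hi, mul_zero]

/-- Moore-type nondegeneracy: if `h` is linearly independent over the fixed field of `θ`, then a
vector annihilating all conjugates of `h` under powers of `θ` is zero. -/
theorem eq_zero_of_sum_mul_zpow_apply_eq_zero {L ι : Type*} [Field L] [Fintype ι]
    (θ : L ≃+* L) (h : ι → L) (hh : LinearIndependent (fixedField θ) h) (v : ι → L)
    (hv : ∀ i : ℤ, ∑ j, v j * (θ ^ i) (h j) = 0) : v = 0 := by
  classical
  have hfixed : FixedPoints.subfield (Subgroup.zpowers θ) L = fixedField θ := by
    ext x
    refine ⟨fun hx => hx ⟨θ, Subgroup.mem_zpowers θ⟩, fun hx => ?_⟩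
    rintro ⟨g, hg⟩
    have hle : Subgroup.zpowers θ ≤ MulAction.stabilizer (L ≃+* L) x := by
      rw [Subgroup.zpowers_le]
      exact hx
    exact hle hg
  rw [← hfixed] at hh
  have hs : LinearIndepOn (FixedPoints.subfield (Subgroup.zpowers θ) L) id
      ((Finset.univ.image h : Finset L) : Set L) := by
    rw [Finset.coe_image, Finset.coe_univ, Set.image_univ]
    exact hh.linearIndepOn_id
  have hsmul := FixedPoints.linearIndependent_smul_of_linearIndependent (Subgroup.zpowers θ) L hs
  have hcomp : LinearIndependent L
      (fun j => MulAction.toFun (Subgroup.zpowers θ) L (h j)) :=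
    hsmul.comp (fun j => ⟨h j, by simp⟩) fun a b hab => hh.injective (congrArg Subtype.val hab)
  funext j
  refine Fintype.linearIndependent_iff.1 hcomp v ?_ j
  funext ⟨g, i, hg⟩
  subst hg
  simp only [Finset.sum_apply, Pi.smul_apply, smul_eq_mul, Pi.zero_apply]
  exact hv i

/-- For `F`-rational `c`, whether `c` is orthogonal to `θ ^ i (h)` depends only on the class of `i`
modulo the order of `σ`. -/
theorem sum_mul_zpow_apply_eq_zero_of_intCast_eq {F L ι : Type*} [Field F] [Field L] [Algebra F L]
    [Fintype ι] (σ : F ≃+* F) (θ : L ≃+* L)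
    (hres : ∀ x : F, θ (algebraMap F L x) = algebraMap F L (σ x)) (h : ι → L) (c : ι → F)
    {i k : ℤ} (hik : (i : ZMod (orderOf σ)) = k)
    (hi : ∑ j, algebraMap F L (c j) * (θ ^ i) (h j) = 0) :
    ∑ j, algebraMap F L (c j) * (θ ^ k) (h j) = 0 := by
  obtain ⟨d, hd⟩ := (ZMod.intCast_eq_intCast_iff_dvd_sub i k (orderOf σ)).1 hik
  have hpow : ∀ (n : ℕ) (x : F), (θ ^ n) (algebraMap F L x) = algebraMap F L ((σ ^ n) x) := by
    intro n
    induction n with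
    | zero => intro x; rfl
    | succ n ih => intro x; rw [pow_succ, pow_succ, RingAut.mul_apply, RingAut.mul_apply, hres, ih]
  have hle : Subgroup.zpowers (θ ^ orderOf σ) ≤
      ⨅ x : F, MulAction.stabilizer (L ≃+* L) (algebraMap F L x) := by
    rw [Subgroup.zpowers_le, Subgroup.mem_iInf]
    intro x
    change (θ ^ orderOf σ) (algebraMap F L x) = algebraMap F L x
    rw [hpow, pow_orderOf_eq_one]
    rfl
  have hfixF : ∀ x : F, (θ ^ (k - i)) (algebraMap F L x) = algebraMap F L x := by
    intro x
    refine Subgroup.mem_iInf.1 (hle ?_) x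
    rw [hd, zpow_mul, zpow_natCast]
    exact Subgroup.zpow_mem_zpowers _ _
  have := congrArg (θ ^ (k - i)) hi
  rw [map_sum, map_zero] at this
  rw [← this]
  refine Finset.sum_congr rfl fun j _ => ?_
  rw [map_mul, hfixF, ← RingAut.mul_apply, ← zpow_add, sub_add_cancel]

/-- The `F`-linear map sending `c` to its products with the first `m` conjugates of `h`. -/
def conjugateEval {F L : Type*} [Field F] [Field L] [Algebra F L] {ι : Type*} [Fintype ι]
    (θ : L ≃+* L) (h : ι → L) (m : ℕ) : (ι → F) →ₗ[F] (ZMod m → L) where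
  toFun c i := ∑ j, algebraMap F L (c j) * (θ ^ (i.val : ℤ)) (h j)
  map_add' a b := by
    funext i
    simp [add_mul, Finset.sum_add_distrib]
  map_smul' t a := by
    funext i
    simp [Algebra.smul_def, mul_assoc, Finset.mul_sum]

/-- **Dimension of the subfield subcode**: for `n = ℓ·m`, the `F`-dimension of
`C_(θ,h,T) ∩ F^n` is `ℓ·(m − κ)`, where `κ` is the number of distinct residues modulo `m`
of the elements of `T`. -/
theorem subfield_subcode_finrank {F L : Type*} [Field F] [Field L] [Algebra F L]
    (σ : F ≃+* F) (m : ℕ) (hm0 : 0 < m) (hord : orderOf σ = m)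
    (θ : L ≃+* L) (ℓ : ℕ) (hdeg : Module.finrank F L = ℓ)
    (hres : ∀ x : F, θ (algebraMap F L x) = algebraMap F L (σ x))
    (hfix : ∀ y : L, θ y = y ↔ ∃ x : F, σ x = x ∧ algebraMap F L x = y)
    (h : Fin (ℓ * m) → L) (hh : LinearIndependent (fixedField θ) h)
    (T : Set ℤ)
    (κ : ℕ) (hκ : κ = Set.ncard ((fun x : ℤ => (x : ZMod m)) '' T)) :
    Module.finrank F (subfieldSubcode (F := F) θ h T) = ℓ * (m - κ) := by
  classical
  rcases Nat.eq_zero_or_pos ℓ with hℓ | hℓ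
  · subst hℓ
    have : IsEmpty (Fin (0 * m)) := by rw [zero_mul]; infer_instance
    rw [Module.finrank_zero_of_subsingleton, zero_mul]
  have : NeZero m := ⟨hm0.ne'⟩
  have : Module.Finite F L := Module.finite_of_finrank_pos (hdeg ▸ hℓ)
  have hval (i : ℤ) : (((i : ZMod m).val : ℤ) : ZMod m) = i := by simp
  have hcongr {i k : ℤ} (hik : (i : ZMod m) = k) (c : Fin (ℓ * m) → F)
      (hi : ∑ j, algebraMap F L (c j) * (θ ^ i) (h j) = 0) :
      ∑ j, algebraMap F L (c j) * (θ ^ k) (h j) = 0 := by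
    subst hord
    exact sum_mul_zpow_apply_eq_zero_of_intCast_eq σ θ hres h c hik hi
  have hinj : Function.Injective (conjugateEval (F := F) θ h m) := by
    rw [← LinearMap.ker_eq_bot, LinearMap.ker_eq_bot']
    intro c hc
    have := eq_zero_of_sum_mul_zpow_apply_eq_zero θ h hh (fun j => algebraMap F L (c j))
      fun i => hcongr (hval i) c (congrFun hc (i : ZMod m))
    funext j
    exact (algebraMap F L).injective ((congrFun this j).trans (map_zero _).symm)
  have hsurj : Function.Surjective (conjugateEval (F := F) θ h m) := by
    refine (LinearMap.injective_iff_surjective_of_finrank_eq_finrank ?_).1 hinj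
    rw [Module.finrank_pi, Module.finrank_pi_fintype]
    simp [hdeg, ZMod.card, mul_comm]
  set S : Set (ZMod m) := (fun x : ℤ => (x : ZMod m)) '' T
  let Φ : (Fin (ℓ * m) → F) →ₗ[F] (S → L) :=
    LinearMap.funLeft F L (Subtype.val : S → ZMod m) ∘ₗ conjugateEval θ h m
  have hΦ : Function.Surjective Φ :=
    (LinearMap.funLeft_surjective_of_injective F L _ Subtype.val_injective).comp hsurj
  have hker : LinearMap.ker Φ = subfieldSubcode (F := F) θ h T := by
    ext c
    rw [LinearMap.mem_ker]
    constructor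
    · intro hc i hi
      exact hcongr (hval i) c (congrFun hc ⟨(i : ZMod m), i, hi, rfl⟩)
    · intro hc
      funext ⟨s, i, hi, his⟩
      subst his
      exact hcongr (hval i).symm c (hc i hi)
  have hrank := Φ.finrank_range_add_finrank_ker
  rw [LinearMap.range_eq_top.2 hΦ, finrank_top, hker, Module.finrank_pi_fintype,
    Module.finrank_pi] at hrank
  simp only [hdeg, Finset.sum_const, Finset.card_univ, smul_eq_mul, ← Nat.card_eq_fintype_card, Nat.card_fin,
    Nat.card_coe_set_eq, ← hκ] at hrank
  rw [Nat.mul_sub, mul_comm ℓ κ]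
  exact Nat.eq_sub_of_add_eq' hrank
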